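/- Let s, t be positive integers and let β_1,…,β_s, γ_1,…,γ_t be integers with Σ_{i=1}^s β_i + Σ_{j=1}^t γ_j = 1. Consider the complete bipartite graph whose left nodes are A_1,…,A_s together with A_{jj'} for 1 ≤ j < j' ≤ t, and whose right nodes are B_1,…,B_t together with B_{ii'} for 1 ≤ i < i' ≤ s. Then for all sign assignments a_i, a_{jj'}, b_j, b_{ii'} ∈ {−1,+1} to these nodes, the following inequality holds: Σ_{1≤i≤s} Σ_{1≤j≤t} β_i γ_j (a_i b_j) + Σ_{1≤i<i'≤s} (β_i β_{i'} (a_i b_{ii'}) − |β_i β_{i'}| (a_{i'} b_{ii'})) + Σ_{1≤j<j'≤t} (γ_j γ_{j'} (a_{jj'} b_j) − |γ_j γ_{j'}| (a_{jj'} b_{j'})) ≥ Σ_{1≤i≤s} Σ_{1≤j≤t} β_i γ_j + 2 Σ_{1≤i<i'≤s, β_iβ_{i'}<0} β_i β_{i'} + 2 Σ_{1≤j<j'≤t, γ_jγ_{j'}<0} γ_j γ_{j'}. Consequently, this linear inequality is valid for the cut polytope of this complete bipartite graph (with m = s + t(t−1)/2 left nodes and n = t + s(s−1)/2 right nodes).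 -/

import Mathlib

open Finset

/-- Left node type of the bipartite graph: the nodes `A_1,…,A_s` together with
the nodes `A_{jj'}` for `1 ≤ j < j' ≤ t`. -/
abbrev LeftNode (s t : ℕ) := Fin s ⊕ {p : Fin t × Fin t // p.1 < p.2}

/-- Right node type: the nodes `B_1,…,B_t` together with the nodes `B_{ii'}`
for `1 ≤ i < i' ≤ s`. -/
abbrev RightNode (s t : ℕ) := Fin t ⊕ {p : Fin s × Fin s // p.1 < p.2}

/-- The cut vectors of the complete bipartite graph on these node sets. -/
def cutVectorsLR (s t : ℕ) : Set (LeftNode s t → RightNode s t → ℝ) :=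
  {x | ∃ (a : LeftNode s t → ℝ) (b : RightNode s t → ℝ),
    (∀ u, a u = 1 ∨ a u = -1) ∧ (∀ v, b v = 1 ∨ b v = -1) ∧
    x = fun u v => a u * b v}

/-- The left hand side of the correlation inequality derived from a
hypermetric inequality via triangular elimination, evaluated at `x`. -/
def lhs (s t : ℕ) (β : Fin s → ℤ) (γ : Fin t → ℤ)
    (x : LeftNode s t → RightNode s t → ℝ) : ℝ :=
  (∑ i, ∑ j, (β i : ℝ) * (γ j : ℝ) * x (Sum.inl i) (Sum.inl j)) +
  (∑ e : {p : Fin s × Fin s // p.1 < p.2},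
      ((β e.1.1 : ℝ) * (β e.1.2 : ℝ) * x (Sum.inl e.1.1) (Sum.inr e) -
       |(β e.1.1 : ℝ) * (β e.1.2 : ℝ)| * x (Sum.inl e.1.2) (Sum.inr e))) +
  (∑ e : {p : Fin t × Fin t // p.1 < p.2},
      ((γ e.1.1 : ℝ) * (γ e.1.2 : ℝ) * x (Sum.inr e) (Sum.inl e.1.1) -
       |(γ e.1.1 : ℝ) * (γ e.1.2 : ℝ)| * x (Sum.inr e) (Sum.inl e.1.2)))

/-- The right hand side of the correlation inequality. -/
def rhs (s t : ℕ) (β : Fin s → ℤ) (γ : Fin t → ℤ) : ℝ :=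
  (∑ i, ∑ j, (β i : ℝ) * (γ j : ℝ)) +
  2 * (∑ e ∈ Finset.univ.filter
        (fun e : {p : Fin s × Fin s // p.1 < p.2} => β e.1.1 * β e.1.2 < 0),
        (β e.1.1 : ℝ) * (β e.1.2 : ℝ)) +
  2 * (∑ e ∈ Finset.univ.filter
        (fun e : {p : Fin t × Fin t // p.1 < p.2} => γ e.1.1 * γ e.1.2 < 0),
        (γ e.1.1 : ℝ) * (γ e.1.2 : ℝ))

theorem sum_sq_eq_sum_sq_add_two_mul_sum_lt {ι : Type*} [Fintype ι] [LinearOrder ι] (f : ι → ℝ) :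
    (∑ i, f i) ^ 2 =
      ∑ i, f i ^ 2 + 2 * ∑ e : {p : ι × ι // p.1 < p.2}, f e.1.1 * f e.1.2 := by
  have hsub : ∑ e : {p : ι × ι // p.1 < p.2}, f e.1.1 * f e.1.2 =
      ∑ i, ∑ j, if i < j then f i * f j else 0 := by
    rw [← Fintype.sum_prod_type' (fun i j => if i < j then f i * f j else 0),
      ← Finset.sum_filter]
    exact (Finset.sum_subtype _ (by simp) (fun p : ι × ι => f p.1 * f p.2)).symm
  have hswap : (∑ i, ∑ j, if j < i then f i * f j else 0) =
      ∑ i, ∑ j, if i < j then f i * f j else 0 := by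
    rw [Finset.sum_comm]
    simp only [mul_comm]
  have hdiag : ∑ i, f i ^ 2 = ∑ i, ∑ j, if i = j then f i * f j else 0 := by
    simp [sq]
  rw [hsub, two_mul, hdiag]
  nth_rewrite 2 [← hswap]
  rw [sq, Finset.sum_mul_sum]
  simp only [← Finset.sum_add_distrib]
  refine Finset.sum_congr rfl fun i _ => Finset.sum_congr rfl fun j _ => ?_
  rcases lt_trichotomy i j with h | h | h
  · simp [h, h.ne, h.not_gt]
  · simp [h]
  · simp [h, h.ne', h.not_gt]

theorem sum_sq_mul_sign {ι : Type*} [Fintype ι] (c a : ι → ℝ) (ha : ∀ i, a i = 1 ∨ a i = -1) :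
    ∑ i, (c i * a i) ^ 2 = ∑ i, c i ^ 2 := by
  refine Finset.sum_congr rfl fun i _ => ?_
  rcases ha i with h | h <;> rw [h] <;> ring

theorem exists_sum_mul_sign_eq {ι : Type*} [Fintype ι] (c : ι → ℤ) (a : ι → ℝ)
    (ha : ∀ i, a i = 1 ∨ a i = -1) :
    ∃ k : ℤ, ∑ i, (c i : ℝ) * a i = ((∑ i, c i + 2 * k : ℤ) : ℝ) := by
  have h : ∀ i, ∃ k : ℤ, (c i : ℝ) * a i = c i + 2 * k := fun i => by
    rcases ha i with h | h
    · exact ⟨0, by simp [h]⟩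
    · exact ⟨-c i, by rw [h]; push_cast; ring⟩
  choose k hk using h
  refine ⟨∑ i, k i, ?_⟩
  push_cast
  rw [Finset.mul_sum, ← Finset.sum_add_distrib]
  exact Finset.sum_congr rfl fun i _ => hk i

theorem triangle_term_lower_bound (c : ℤ) {x y z : ℝ} (hx : x = 1 ∨ x = -1)
    (hy : y = 1 ∨ y = -1) (hz : z = 1 ∨ z = -1) :
    (c : ℝ) * (x * y) - c + 2 * (if c < 0 then (c : ℝ) else 0) ≤
      c * (x * z) - |(c : ℝ)| * (y * z) := by
  split_ifs with h
  · have h' : (c : ℝ) < 0 := by exact_mod_cast h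
    rw [abs_of_neg h']
    rcases hx with rfl | rfl <;> rcases hy with rfl | rfl <;> rcases hz with rfl | rfl <;> linarith
  · have h' : (0 : ℝ) ≤ c := by exact_mod_cast not_lt.mp h
    rw [abs_of_nonneg h']
    rcases hx with rfl | rfl <;> rcases hy with rfl | rfl <;> rcases hz with rfl | rfl <;> linarith

theorem sum_triangle_term_lower_bound {n : ℕ} (c : Fin n → ℤ) (a : Fin n → ℝ)
    (b : {p : Fin n × Fin n // p.1 < p.2} → ℝ)
    (ha : ∀ i, a i = 1 ∨ a i = -1) (hb : ∀ e, b e = 1 ∨ b e = -1) :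
    ((∑ i, (c i : ℝ) * a i) ^ 2 - (∑ i, (c i : ℝ)) ^ 2) / 2 +
      2 * (∑ e ∈ Finset.univ.filter
        (fun e : {p : Fin n × Fin n // p.1 < p.2} => c e.1.1 * c e.1.2 < 0),
        (c e.1.1 : ℝ) * (c e.1.2 : ℝ)) ≤
    ∑ e : {p : Fin n × Fin n // p.1 < p.2},
      ((c e.1.1 : ℝ) * (c e.1.2 : ℝ) * (a e.1.1 * b e) -
       |(c e.1.1 : ℝ) * (c e.1.2 : ℝ)| * (a e.1.2 * b e)) := by
  rw [sum_sq_eq_sum_sq_add_two_mul_sum_lt, sum_sq_eq_sum_sq_add_two_mul_sum_lt,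
    sum_sq_mul_sign _ _ ha, Finset.sum_filter]
  have h := Finset.sum_le_sum fun (e : {p : Fin n × Fin n // p.1 < p.2}) (_ : e ∈ Finset.univ) =>
    triangle_term_lower_bound (c e.1.1 * c e.1.2) (ha e.1.1) (ha e.1.2) (hb e)
  push_cast at h
  refine le_trans (le_of_eq ?_) h
  rw [Finset.sum_add_distrib, Finset.sum_sub_distrib, ← Finset.mul_sum]
  simp only [mul_mul_mul_comm]
  ring

theorem rhs_le_lhs_of_sign (s t : ℕ) (β : Fin s → ℤ) (γ : Fin t → ℤ)
    (hsum : ∑ i, β i + ∑ j, γ j = 1) (a : LeftNode s t → ℝ) (b : RightNode s t → ℝ)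
    (ha : ∀ u, a u = 1 ∨ a u = -1) (hb : ∀ v, b v = 1 ∨ b v = -1) :
    rhs s t β γ ≤ lhs s t β γ (fun u v => a u * b v) := by
  have hβ := sum_triangle_term_lower_bound β (fun i => a (Sum.inl i)) (fun e => b (Sum.inr e))
    (fun _ => ha _) (fun _ => hb _)
  have hγ := sum_triangle_term_lower_bound γ (fun j => b (Sum.inl j)) (fun e => a (Sum.inr e))
    (fun _ => hb _) (fun _ => ha _)
  obtain ⟨k, hk⟩ := exists_sum_mul_sign_eq β (fun i => a (Sum.inl i)) (fun _ => ha _)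
  obtain ⟨l, hl⟩ := exists_sum_mul_sign_eq γ (fun j => b (Sum.inl j)) (fun _ => hb _)
  have hodd : (1 : ℝ) ≤
      (∑ i, (β i : ℝ) * a (Sum.inl i) + ∑ j, (γ j : ℝ) * b (Sum.inl j)) ^ 2 := by
    rw [hk, hl, ← Int.cast_add]
    have hne : ∑ i, β i + 2 * k + (∑ j, γ j + 2 * l) ≠ 0 := by omega
    have hpos := sq_pos_of_ne_zero hne
    exact_mod_cast hpos
  have hone : (∑ i, (β i : ℝ)) + ∑ j, (γ j : ℝ) = 1 := by exact_mod_cast hsum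
  have hone_sq : ((∑ i, (β i : ℝ)) + ∑ j, (γ j : ℝ)) ^ 2 = 1 := by rw [hone, one_pow]
  have hcross : ∑ i, ∑ j, (β i : ℝ) * (γ j : ℝ) * (a (Sum.inl i) * b (Sum.inl j)) =
      (∑ i, (β i : ℝ) * a (Sum.inl i)) * ∑ j, (γ j : ℝ) * b (Sum.inl j) := by
    rw [Finset.sum_mul_sum]
    simp only [mul_mul_mul_comm]
  simp only [mul_comm (b (Sum.inl _))] at hγ
  unfold rhs lhs
  rw [hcross, ← Finset.sum_mul_sum]
  linarith

theorem lhs_smul_add_smul (s t : ℕ) (β : Fin s → ℤ) (γ : Fin t → ℤ) (p q : ℝ)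
    (x y : LeftNode s t → RightNode s t → ℝ) :
    lhs s t β γ (p • x + q • y) = p * lhs s t β γ x + q * lhs s t β γ y := by
  unfold lhs
  simp only [Pi.add_apply, Pi.smul_apply, smul_eq_mul, mul_add, Finset.mul_sum]
  rw [add_add_add_comm, add_add_add_comm (∑ i, ∑ j, _)]
  simp only [← Finset.sum_add_distrib]
  congr 1
  · congr 1
    · exact Finset.sum_congr rfl fun i _ => Finset.sum_congr rfl fun j _ => by ring
    · exact Finset.sum_congr rfl fun e _ => by ring
  · exact Finset.sum_congr rfl fun e _ => by ring

/-- The correlation inequality obtained by triangular elimination from a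
hypermetric inequality: it holds for every cut vector of the complete
bipartite graph, and consequently it is valid for its cut polytope. -/
theorem hypermetric_correlation_inequality (s t : ℕ) (hs : 0 < s) (ht : 0 < t)
    (β : Fin s → ℤ) (γ : Fin t → ℤ)
    (hsum : ∑ i, β i + ∑ j, γ j = 1) :
    (∀ (a : LeftNode s t → ℝ) (b : RightNode s t → ℝ),
      (∀ u, a u = 1 ∨ a u = -1) → (∀ v, b v = 1 ∨ b v = -1) →
      rhs s t β γ ≤ lhs s t β γ (fun u v => a u * b v)) ∧
    (∀ x ∈ convexHull ℝ (cutVectorsLR s t), rhs s t β γ ≤ lhs s t β γ x) := by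
  have hsign := rhs_le_lhs_of_sign s t β γ hsum
  refine ⟨hsign, fun x hx => ?_⟩
  have hconv : Convex ℝ {x | rhs s t β γ ≤ lhs s t β γ x} := by
    intro x hx y hy p q hp hq hpq
    simp only [Set.mem_ofPred_eq] at hx hy ⊢
    rw [lhs_smul_add_smul]
    calc rhs s t β γ = p * rhs s t β γ + q * rhs s t β γ := by rw [← add_mul, hpq, one_mul]
      _ ≤ _ := by gcongr
  refine convexHull_min ?_ hconv hx
  rintro _ ⟨a, b, ha, hb, rfl⟩
  exact hsign a b ha hb
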